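/- arXiv:1001.1559 — 2 statements merged into one kernel-verified Lean document; each statement's English description precedes it below -/
import Mathlib

section
/- Invariance of the closed-braid class in V_3 under 3-braid flype moves: for all integers a, b, c and every ε ∈ {+1, −1}, the images in V_3 of the two elements T_1^a · T_2^b · T_1^c · T_2^ε and T_1^a · T_2^ε · T_1^c · T_2^b of H_3 are equal, where integer powers of the units T_1, T_2 are taken in the group of units of H_3. (The exchange move on 3-braids is the special case b ∈ {+1, −1} with b = −ε.) -/
/-- The defining relations of the Iwahori–Hecke algebra `H_n` on generators
`T_1, …, T_{n-1}` (indexed by `i : Fin (n-1)`, with `i` standing for `T_{i+1}`). -/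
inductive HeckeRel (R : Type) [CommRing R] (A B : Rˣ) (n : ℕ) :
    FreeAlgebra R (Fin (n - 1)) → FreeAlgebra R (Fin (n - 1)) → Prop
  | comm (i j : Fin (n - 1)) (h : (i : ℕ) + 1 < (j : ℕ)) :
      HeckeRel R A B n (FreeAlgebra.ι R i * FreeAlgebra.ι R j)
        (FreeAlgebra.ι R j * FreeAlgebra.ι R i)
  | braid (i j : Fin (n - 1)) (h : (j : ℕ) = (i : ℕ) + 1) :
      HeckeRel R A B n (FreeAlgebra.ι R i * FreeAlgebra.ι R j * FreeAlgebra.ι R i)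
        (FreeAlgebra.ι R j * FreeAlgebra.ι R i * FreeAlgebra.ι R j)
  | quad (i : Fin (n - 1)) :
      HeckeRel R A B n (FreeAlgebra.ι R i * FreeAlgebra.ι R i)
        ((B : R) • FreeAlgebra.ι R i + algebraMap R (FreeAlgebra R (Fin (n - 1))) (A : R))

/-- The Iwahori–Hecke algebra `H_n`. -/
abbrev Hecke (R : Type) [CommRing R] (A B : Rˣ) (n : ℕ) : Type :=
  RingQuot (HeckeRel R A B n)

/-- The generator `T_{i+1}` of the Iwahori–Hecke algebra. -/
noncomputable def Tgen (R : Type) [CommRing R] (A B : Rˣ) (n : ℕ) (i : Fin (n - 1)) :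
    Hecke R A B n :=
  RingQuot.mkAlgHom R (HeckeRel R A B n) (FreeAlgebra.ι R i)



/-- The `R`-submodule of `H_n` spanned by all commutators `x*y - y*x`. -/
def commSub (R : Type) [CommRing R] (A B : Rˣ) (n : ℕ) : Submodule R (Hecke R A B n) :=
  Submodule.span R {z : Hecke R A B n | ∃ x y : Hecke R A B n, z = x * y - y * x}

/-- The module `V_n`, the quotient of `H_n` by the span of all commutators. -/
abbrev Vmod (R : Type) [CommRing R] (A B : Rˣ) (n : ℕ) : Type :=
  Hecke R A B n ⧸ commSub R A B n

/-- The quotient map `π : H_n → V_n`. -/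
noncomputable def piV (R : Type) [CommRing R] (A B : Rˣ) (n : ℕ) :
    Hecke R A B n →ₗ[R] Vmod R A B n :=
  (commSub R A B n).mkQ

theorem piV_mul_comm (R : Type) [CommRing R] (A B : Rˣ) (n : ℕ) (x y : Hecke R A B n) :
    piV R A B n (x * y) = piV R A B n (y * x) := by
  rw [← sub_eq_zero, ← map_sub]
  refine (Submodule.Quotient.mk_eq_zero _).2 (Submodule.subset_span ⟨x, y, rfl⟩)

/-- Integer powers of a unit satisfying a quadratic relation are linear in it. -/
theorem zpow_linear {R H : Type} [CommRing R] [Ring H] [Algebra R H] (A B : Rˣ) (u : Hˣ)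
    (h : (u : H) * u = (B : R) • (u : H) + (A : R) • (1 : H)) (k : ℤ) :
    ∃ p q : R, ((u ^ k : Hˣ) : H) = p • (1 : H) + q • (u : H) := by
  have hinv : ((u⁻¹ : Hˣ) : H) = ((A⁻¹ : Rˣ) : R) • ((u : H) - (B : R) • (1 : H)) := by
    apply Units.inv_eq_of_mul_eq_one_right
    rw [mul_smul_comm, mul_sub, h, mul_smul_comm, mul_one, add_sub_cancel_left, smul_smul,
      Units.inv_mul, one_smul]
  induction k using Int.induction_on with
  | zero => exact ⟨1, 0, by simp⟩
  | succ i ih =>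
    obtain ⟨p, q, hk⟩ := ih
    refine ⟨q * A, p + q * B, ?_⟩
    rw [zpow_add_one, Units.val_mul, hk, add_mul, smul_mul_assoc, smul_mul_assoc, h, one_mul]
    module
  | pred i ih =>
    obtain ⟨p, q, hk⟩ := ih
    refine ⟨q - p * ((A⁻¹ : Rˣ) : R) * B, p * ((A⁻¹ : Rˣ) : R), ?_⟩
    rw [zpow_sub_one, Units.val_mul, hk, add_mul, smul_mul_assoc, smul_mul_assoc, Units.mul_inv,
      one_mul, hinv]
    module

theorem Tgen_quad (R : Type) [CommRing R] (A B : Rˣ) (n : ℕ) (i : Fin (n - 1)) :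
    Tgen R A B n i * Tgen R A B n i
      = (B : R) • Tgen R A B n i + (A : R) • (1 : Hecke R A B n) := by
  have := RingQuot.mkAlgHom_rel R (HeckeRel.quad (R := R) (A := A) (B := B) (n := n) i)
  rw [map_mul, map_add, map_smul, AlgHom.commutes, Algebra.algebraMap_eq_smul_one] at this
  exact this


/-- Invariance of the closed-braid class in `V_3` under 3-braid flype
moves: for all integers `a, b, c` and `ε ∈ {1, -1}`, the images in `V_3` of
`T_1^a T_2^b T_1^c T_2^ε` and `T_1^a T_2^ε T_1^c T_2^b` agree. -/
theorem flype_invariance_V3 (R : Type) [CommRing R] [IsDomain R] (A B : Rˣ)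
    (u₁ u₂ : (Hecke R A B 3)ˣ)
    (hu₁ : (u₁ : Hecke R A B 3) = Tgen R A B 3 0)
    (hu₂ : (u₂ : Hecke R A B 3) = Tgen R A B 3 1)
    (a b c ε : ℤ) (hε : ε = 1 ∨ ε = -1) :
    piV R A B 3 ((u₁ ^ a * u₂ ^ b * u₁ ^ c * u₂ ^ ε : (Hecke R A B 3)ˣ) : Hecke R A B 3) =
      piV R A B 3
        ((u₁ ^ a * u₂ ^ ε * u₁ ^ c * u₂ ^ b : (Hecke R A B 3)ˣ) : Hecke R A B 3) := by
  obtain ⟨p, q, hb⟩ := zpow_linear A B u₂ (by rw [hu₂]; exact Tgen_quad R A B 3 1) b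
  obtain ⟨r, s, he⟩ := zpow_linear A B u₂ (by rw [hu₂]; exact Tgen_quad R A B 3 1) ε
  have hc : ((u₁ ^ a : (Hecke R A B 3)ˣ) : Hecke R A B 3) * (u₁ ^ c : (Hecke R A B 3)ˣ)
      = (u₁ ^ c : (Hecke R A B 3)ˣ) * (u₁ ^ a : (Hecke R A B 3)ˣ) := by
    rw [← Units.val_mul, ← Units.val_mul, zpow_mul_comm]
  simp only [Units.val_mul, hb, he]
  generalize ((u₁ ^ a : (Hecke R A B 3)ˣ) : Hecke R A B 3) = P at *
  generalize ((u₁ ^ c : (Hecke R A B 3)ˣ) : Hecke R A B 3) = Q at *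
  generalize (u₂ : Hecke R A B 3) = T at *
  have key : piV R A B 3 (P * T * Q) = piV R A B 3 (P * Q * T) := by
    rw [piV_mul_comm, hc, mul_assoc]
  simp only [mul_add, add_mul, mul_smul_comm, smul_mul_assoc, mul_one, map_add, map_smul, key]
  module
end

section
/- V_n is a free R-module whose rank equals P(n), the number of partitions of the integer n. -/
namespace HeckeAux

/-- indices of the generators in the Coxeter element of a composition, starting at strand `s` -/
def gl : ℕ → List ℕ → List ℕ
  | _, [] => []
  | s, a :: l => List.range' s (a - 1) ++ gl (s + a) l

/-- product of generators along a list of indices -/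
def wp {H : Type*} [Monoid H] (t : ℕ → H) (L : List ℕ) : H := (L.map t).prod

lemma wp_nil {H : Type*} [Monoid H] (t : ℕ → H) : wp t [] = 1 := by simp [wp]
lemma wp_cons {H : Type*} [Monoid H] (t : ℕ → H) (i : ℕ) (L : List ℕ) :
    wp t (i :: L) = t i * wp t L := by simp [wp]
lemma wp_append {H : Type*} [Monoid H] (t : ℕ → H) (L L' : List ℕ) :
    wp t (L ++ L') = wp t L * wp t L' := by simp [wp]

lemma gl_mem {s : ℕ} {l : List ℕ} {i : ℕ} (h : i ∈ gl s l) : s ≤ i ∧ i + 1 < s + l.sum := by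
  induction l generalizing s with
  | nil => simp [gl] at h
  | cons a l ih =>
    simp only [gl, List.mem_append, List.mem_range'_1, List.sum_cons] at h ⊢
    rcases h with h | h
    · omega
    · have := ih h
      omega

lemma gl_sorted (s : ℕ) (l : List ℕ) : (gl s l).Pairwise (· < ·) := by
  induction l generalizing s with
  | nil => simp [gl]
  | cons a l ih =>
    simp only [gl]
    rw [List.pairwise_append]
    refine ⟨List.pairwise_lt_range', ih _, ?_⟩
    intro x hx y hy
    have := (gl_mem hy).1
    simp only [List.mem_range'_1] at hx
    omega

lemma gl_append (s : ℕ) (l l' : List ℕ) : gl s (l ++ l') = gl s l ++ gl (s + l.sum) l' := by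
  induction l generalizing s with
  | nil => simp [gl]
  | cons a l ih => simp [gl, ih, add_assoc]

section braid
variable {H : Type*} [Monoid H] (t : ℕ → H)

lemma wp_comm (u : H) (L : List ℕ) (h : ∀ i ∈ L, u * t i = t i * u) :
    u * wp t L = wp t L * u := by
  induction L with
  | nil => simp [wp]
  | cons i L ih =>
    rw [wp_cons, ← mul_assoc, h i (by simp), mul_assoc, ih (fun j hj => h j (by simp [hj])),
      mul_assoc]

lemma wp_conj (u : H) (f : ℕ → ℕ) (L : List ℕ) (h : ∀ i ∈ L, u * t i = t (f i) * u) :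
    u * wp t L = wp t (L.map f) * u := by
  induction L with
  | nil => simp [wp]
  | cons i L ih =>
    rw [List.map_cons, wp_cons, wp_cons, ← mul_assoc, h i (by simp), mul_assoc,
      ih (fun j hj => h j (by simp [hj])), mul_assoc]


lemma wp_comm_lt (hc : ∀ i j, i + 1 < j → t i * t j = t j * t i) (j : ℕ) (L : List ℕ) (h : ∀ i ∈ L, j + 1 < i) :
    wp t L * t j = t j * wp t L :=
  (wp_comm t (t j) L fun i hi => hc _ _ (h i hi)).symm

lemma wp_comm_gt (hc : ∀ i j, i + 1 < j → t i * t j = t j * t i) (j : ℕ) (L : List ℕ) (h : ∀ i ∈ L, i + 1 < j) :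
    wp t L * t j = t j * wp t L :=
  (wp_comm t (t j) L fun i hi => (hc _ _ (h i hi)).symm).symm

/-- `δ = t_s … t_{s+k-1}` -/
def dl (s k : ℕ) : H := wp t (List.range' s k)

lemma dl_shift (hc : ∀ i j, i + 1 < j → t i * t j = t j * t i)
    (hb : ∀ i, t i * t (i + 1) * t i = t (i + 1) * t i * t (i + 1)) (s k i : ℕ) (h1 : s ≤ i) (h2 : i + 1 < s + k) :
    dl t s k * t i = t (i + 1) * dl t s k := by
  obtain ⟨p, rfl⟩ := Nat.exists_eq_add_of_le h1
  obtain ⟨r, rfl⟩ : ∃ r, k = p + (2 + r) := ⟨k - p - 2, by omega⟩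
  have e : List.range' s (p + (2 + r)) =
      List.range' s p ++ ((s + p) :: (s + p + 1) :: List.range' (s + p + 2) r) := by
    rw [← List.range'_append_1, ← List.range'_append_1]
    simp [List.range']
  unfold dl
  rw [e, wp_append, wp_cons, wp_cons]
  have c1 := wp_comm_lt t hc (s + p) (List.range' (s + p + 2) r) (by
    intro i hi; simp only [List.mem_range'_1] at hi; omega)
  have c2 := wp_comm_gt t hc (s + p + 1) (List.range' s p) (by
    intro i hi; simp only [List.mem_range'_1] at hi; omega)
  have b := hb (s + p)
  simp only [mul_assoc] at *
  rw [c1, ← mul_assoc (t (s+p+1)) (t (s + p)), ← mul_assoc (t (s+p)) (t (s+p+1) * t (s + p)), b]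
  simp only [mul_assoc]
  rw [← mul_assoc, c2]
  simp only [mul_assoc]

lemma dl_pow_shift (hc : ∀ i j, i + 1 < j → t i * t j = t j * t i)
    (hb : ∀ i, t i * t (i + 1) * t i = t (i + 1) * t i * t (i + 1)) (s k i p : ℕ) (h1 : s ≤ i) (h2 : i + p < s + k) :
    dl t s k ^ p * t i = t (i + p) * dl t s k ^ p := by
  induction p with
  | zero => simp
  | succ p ih =>
    rw [pow_succ', mul_assoc, ih (by omega), ← mul_assoc, dl_shift t hc hb s k _ (by omega)
      (by omega), mul_assoc]
    rfl

lemma dl_wrap (hc : ∀ i j, i + 1 < j → t i * t j = t j * t i)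
    (hb : ∀ i, t i * t (i + 1) * t i = t (i + 1) * t i * t (i + 1)) (s k : ℕ) :
    dl t s (k + 1) ^ 2 * t (s + k) = t s * dl t s (k + 1) ^ 2 := by
  have e1 : dl t s (k + 1) = t s * dl t (s + 1) k := by
    simp [dl, List.range'_succ, wp_cons]
  have e2 : dl t s (k + 1) = dl t s k * t (s + k) := by
    simp [dl, List.range'_1_concat, wp_append, wp_cons, wp_nil]
  have e3 : dl t s (k + 1) * dl t s k = dl t (s + 1) k * dl t s (k + 1) := by
    conv_lhs => rw [show dl t s k = wp t (List.range' s k) from rfl]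
    rw [wp_conj t (dl t s (k+1)) (fun i => i + 1)]
    · congr 1
      unfold dl
      congr 1
      simpa [add_comm] using (List.map_add_range' (a := 1) s k 1)
    · intro i hi
      simp only [List.mem_range'_1] at hi
      exact dl_shift t hc hb _ _ _ (by omega) (by omega)
  calc dl t s (k + 1) ^ 2 * t (s + k) = (t s * dl t (s + 1) k) * dl t s (k + 1) * t (s + k) := by
        rw [← e1, pow_two]
    _ = t s * (dl t s (k + 1) * dl t s k) * t (s + k) := by rw [e3]; simp only [mul_assoc]
    _ = t s * (dl t s (k + 1) * (dl t s k * t (s + k))) := by simp only [mul_assoc]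
    _ = _ := by rw [← e2, pow_two]

lemma dl_swap2 (hc : ∀ i j, i + 1 < j → t i * t j = t j * t i)
    (hb : ∀ i, t i * t (i + 1) * t i = t (i + 1) * t i * t (i + 1)) (s a b j : ℕ) (h : j + 1 < b) :
    dl t s (a + b - 1) ^ b * t (s + a + j) = t (s + j) * dl t s (a + b - 1) ^ b := by
  obtain ⟨r, rfl⟩ : ∃ r, b = j + 2 + r := ⟨b - j - 2, by omega⟩
  have e : a + (j + 2 + r) - 1 = (a + j + r) + 1 := by omega
  rw [e]
  rw [pow_add, mul_assoc, dl_pow_shift t hc hb _ _ _ _ (by omega) (by omega), ← mul_assoc,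
    pow_add, mul_assoc (_ ^ j), show s + a + j + r = s + (a + j + r) by omega,
    dl_wrap t hc hb, ← mul_assoc, dl_pow_shift t hc hb _ _ _ _ (by omega) (by omega)]
  simp only [mul_assoc]


lemma wp_unit (N : ℕ) (hu : ∀ i, i < N → IsUnit (t i)) (L : List ℕ) (h : ∀ i ∈ L, i < N) : IsUnit (wp t L) := by
  induction L with
  | nil => simp [wp]
  | cons i L ih =>
    rw [wp_cons]
    exact (hu i (h i (by simp))).mul (ih fun j hj => h j (by simp [hj]))

lemma perm_conj (hc : ∀ i j, i + 1 < j → t i * t j = t j * t i)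
    (hb : ∀ i, t i * t (i + 1) * t i = t (i + 1) * t i * t (i + 1))
    (N : ℕ) (hu : ∀ i, i < N → IsUnit (t i)) {l l' : List ℕ} (hp : l.Perm l') : (∀ x ∈ l, 0 < x) → ∀ s, s + l.sum ≤ N + 1 →
    ∃ u : H, IsUnit u ∧ u * wp t (gl s l) = wp t (gl s l') * u ∧
      ∀ j, j + 1 < s → u * t j = t j * u := by
  induction hp with
  | nil => intro _ s _; exact ⟨1, isUnit_one, by simp, by simp⟩
  | @cons x l l' hp ih =>
    intro hl s hs
    obtain ⟨u, h1, h2, h3⟩ := ih (fun y hy => hl y (by simp [hy])) (s + x) (by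
      simp only [List.sum_cons] at hs; omega)
    refine ⟨u, h1, ?_, ?_⟩
    · simp only [gl, wp_append]
      rw [← mul_assoc, wp_comm t u _ (by
        intro i hi
        simp only [List.mem_range'_1] at hi
        exact h3 i (by omega)), mul_assoc, h2, mul_assoc]
    · intro j hj; exact h3 j (by omega)
  | swap x y l =>
    intro hl s hs
    have hx : 0 < x := hl x (by simp)
    have hy : 0 < y := hl y (by simp)
    simp only [List.sum_cons] at hs
    refine ⟨dl t s (y + x - 1) ^ x, ?_, ?_, ?_⟩
    · refine (wp_unit t N hu _ ?_).pow _
      intro i hi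
      simp only [List.mem_range'_1] at hi
      omega
    · simp only [gl, wp_append]
      have k1 : dl t s (y + x - 1) ^ x * wp t (List.range' s (y - 1)) =
          wp t (List.range' (s + x) (y - 1)) * dl t s (y + x - 1) ^ x := by
        rw [wp_conj t _ (fun i => i + x)]
        · congr 2
          simpa [add_comm] using (List.map_add_range' (a := x) s (y - 1) 1)
        · intro i hi
          simp only [List.mem_range'_1] at hi
          exact dl_pow_shift t hc hb _ _ _ _ (by omega) (by omega)
      have k2 : dl t s (y + x - 1) ^ x * wp t (List.range' (s + y) (x - 1)) =
          wp t (List.range' s (x - 1)) * dl t s (y + x - 1) ^ x := by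
        rw [wp_conj t _ (fun i => i - y)]
        · congr 2
          have := (List.map_add_range' (a := y) s (x - 1) 1)
          rw [add_comm y s] at this
          rw [← this, List.map_map]
          have e : ((fun i => i - y) ∘ fun x => y + x) = id := by funext z; simp
          rw [e, List.map_id]
        · intro i hi
          simp only [List.mem_range'_1] at hi
          obtain ⟨j, rfl⟩ := Nat.exists_eq_add_of_le hi.1
          rw [dl_swap2 t hc hb _ _ _ _ (by omega)]
          congr 2
          omega
      have k3 : dl t s (y + x - 1) ^ x * wp t (gl (s + y + x) l) =
          wp t (gl (s + y + x) l) * dl t s (y + x - 1) ^ x := by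
        apply wp_comm
        intro i hi
        have := (gl_mem hi).1
        apply Commute.pow_left
        apply wp_comm_gt t hc
        intro j hj
        simp only [List.mem_range'_1] at hj
        omega
      have k4 : wp t (List.range' (s + x) (y - 1)) * wp t (List.range' s (x - 1)) =
          wp t (List.range' s (x - 1)) * wp t (List.range' (s + x) (y - 1)) := by
        apply wp_comm
        intro i hi
        apply wp_comm_lt t hc
        intro j hj
        simp only [List.mem_range'_1] at hi hj
        omega
      rw [show s + x + y = s + y + x by omega]
      rw [← mul_assoc, k1, mul_assoc, ← mul_assoc _ (wp t (List.range' (s + y) (x - 1))), k2,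
        mul_assoc, k3, ← mul_assoc, k4]
      simp only [mul_assoc]
    · intro j hj
      apply Commute.pow_left
      apply wp_comm_lt t hc
      intro i hi
      simp only [List.mem_range'_1] at hi
      omega
  | trans h1 h2 ih1 ih2 =>
    intro hl s hs
    obtain ⟨u, a1, a2, a3⟩ := ih1 hl s hs
    obtain ⟨v, b1, b2, b3⟩ := ih2 (fun x hx => hl x (h1.mem_iff.2 hx)) s (by
      rw [← h1.sum_eq]; exact hs)
    refine ⟨v * u, b1.mul a1, ?_, ?_⟩
    · rw [mul_assoc, a2, ← mul_assoc, b2, mul_assoc]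
    · intro j hj
      rw [mul_assoc, a3 j hj, ← mul_assoc, b3 j hj, mul_assoc]
end braid

section span
variable {R H : Type*} [CommRing R] [Ring H] [Algebra R H] (t : ℕ → H)

/-- the subalgebra generated by the first `m` generators -/
def Q (R : Type*) {H : Type*} [CommRing R] [Ring H] [Algebra R H] (t : ℕ → H) (m : ℕ) :
    Subalgebra R H := Algebra.adjoin R (Set.image t (Set.Iio m))

/-- `Q m + Q m t_m Q m` -/
def E (R : Type*) {H : Type*} [CommRing R] [Ring H] [Algebra R H] (t : ℕ → H) (m : ℕ) :
    Submodule R H :=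
  Submodule.span R {x | x ∈ Q R t m ∨ ∃ a ∈ Q R t m, ∃ b ∈ Q R t m, x = a * t m * b}

lemma t_mem_Q {i m : ℕ} (h : i < m) : t i ∈ Q R t m :=
  Algebra.subset_adjoin ⟨i, h, rfl⟩

lemma Q_mono {m k : ℕ} (h : m ≤ k) : Q R t m ≤ Q R t k :=
  Algebra.adjoin_mono (Set.image_mono (Set.Iio_subset_Iio h))

lemma Q_comm (z : H) (m : ℕ) (h : ∀ i, i < m → t i * z = z * t i) (x : H) (hx : x ∈ Q R t m) :
    x * z = z * x := by
  have : Q R t m ≤ Subalgebra.centralizer R {z} := by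
    apply Algebra.adjoin_le
    rintro _ ⟨i, hi, rfl⟩
    simp only [SetLike.mem_coe, Subalgebra.mem_centralizer_iff, Set.mem_singleton_iff, forall_eq]
    exact (h i hi).symm
  have h2 := this hx
  simp only [Subalgebra.mem_centralizer_iff, Set.mem_singleton_iff, forall_eq] at h2
  exact h2.symm

lemma mem_E1 {m : ℕ} {x : H} (h : x ∈ Q R t m) : x ∈ E R t m :=
  Submodule.subset_span (Or.inl h)

lemma mem_E2 {m : ℕ} {a b : H} (ha : a ∈ Q R t m) (hb : b ∈ Q R t m) : a * t m * b ∈ E R t m :=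
  Submodule.subset_span (Or.inr ⟨a, ha, b, hb, rfl⟩)

lemma Q_succ_le_E (hc : ∀ i j, i + 1 < j → t i * t j = t j * t i)
    (hb : ∀ i, t i * t (i + 1) * t i = t (i + 1) * t i * t (i + 1))
    (A B : R) (N : ℕ) (hq : ∀ i, i < N → t i * t i = B • t i + A • (1 : H)) (m : ℕ) :
    m < N → ∀ x ∈ Q R t (m + 1), x ∈ E R t m := by
  induction m with
  | zero =>
    intro hm
    have key : ∀ a ∈ Q R t 0, ∀ b ∈ Q R t 0, t 0 * (a * t 0 * b) ∈ E R t 0 := by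
      intro a ha b hb
      rw [← mul_assoc, ← mul_assoc, ← Q_comm t (t 0) 0 (by simp) a ha, mul_assoc a, hq 0 hm]
      simp only [mul_add, add_mul, smul_mul_assoc, mul_smul_comm, mul_one]
      exact add_mem (Submodule.smul_mem _ _ (mem_E2 t ha hb))
        (Submodule.smul_mem _ _ (mem_E1 t (mul_mem ha hb)))
    have gen : ∀ x ∈ Q R t 1, ∀ y ∈ E R t 0, x * y ∈ E R t 0 := by
      intro x hx
      induction hx using Algebra.adjoin_induction with
      | mem x hx =>
        obtain ⟨i, hi, rfl⟩ := hx
        obtain rfl : i = 0 := by simpa using hi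
        intro y hy
        induction hy using Submodule.span_induction with
        | mem y hy =>
          rcases hy with hy | ⟨a, ha, b, hb, rfl⟩
          · simpa using mem_E2 t (one_mem (Q R t 0)) hy
          · exact key a ha b hb
        | zero => simp
        | add x y _ _ hx hy => rw [mul_add]; exact add_mem hx hy
        | smul r x _ hx => rw [mul_smul_comm]; exact Submodule.smul_mem _ _ hx
      | algebraMap r => intro y hy; rw [← Algebra.smul_def]; exact Submodule.smul_mem _ _ hy
      | add x x' _ _ h h' => intro y hy; rw [add_mul]; exact add_mem (h y hy) (h' y hy)
      | mul x x' _ _ h h' => intro y hy; rw [mul_assoc]; exact h _ (h' y hy)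
    intro x hx
    simpa using gen x hx 1 (mem_E1 t (one_mem _))
  | succ k ih =>
    intro hm
    have key : ∀ a ∈ E R t k, ∀ b ∈ Q R t (k + 1),
        t (k + 1) * (a * t (k + 1) * b) ∈ E R t (k + 1) := by
      intro a ha b hbb
      have cm : ∀ a ∈ Q R t k, a * t (k + 1) = t (k + 1) * a :=
        Q_comm t (t (k + 1)) k (fun i hi => hc _ _ (by omega))
      induction ha using Submodule.span_induction with
      | mem a ha =>
        rcases ha with ha | ⟨c, hcc, d, hd, rfl⟩
        · rw [← mul_assoc, ← mul_assoc, ← cm a ha, mul_assoc a, hq _ hm]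
          have ha' := Q_mono t (Nat.le_succ k) ha
          simp only [mul_add, add_mul, smul_mul_assoc, mul_smul_comm, mul_one]
          exact add_mem (Submodule.smul_mem _ _ (mem_E2 t ha' hbb))
            (Submodule.smul_mem _ _ (mem_E1 t (mul_mem ha' hbb)))
        · have e : t (k + 1) * (c * t k * d * t (k + 1) * b) =
              (c * t k) * t (k + 1) * (t k * d * b) := by
            calc t (k + 1) * (c * t k * d * t (k + 1) * b)
                = (t (k + 1) * c) * t k * (d * t (k + 1)) * b := by simp only [mul_assoc]
              _ = c * (t (k + 1) * t k * t (k + 1)) * d * b := by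
                  rw [← cm c hcc, cm d hd]; simp only [mul_assoc]
              _ = _ := by rw [← hb]; simp only [mul_assoc]
          rw [e]
          have h1 := t_mem_Q (R := R) t (Nat.lt_succ_self k)
          exact mem_E2 t (mul_mem (Q_mono t (Nat.le_succ k) hcc) h1)
            (mul_mem (mul_mem h1 (Q_mono t (Nat.le_succ k) hd)) hbb)
      | zero => simp
      | add x y _ _ hx hy => simp only [mul_add, add_mul]; exact add_mem hx hy
      | smul r x _ hx =>
        simp only [mul_smul_comm, smul_mul_assoc]; exact Submodule.smul_mem _ _ hx
    have gen : ∀ x ∈ Q R t (k + 1 + 1), ∀ y ∈ E R t (k + 1), x * y ∈ E R t (k + 1) := by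
      intro x hx
      induction hx using Algebra.adjoin_induction with
      | mem x hx =>
        obtain ⟨i, hi, rfl⟩ := hx
        have hi' : i < k + 1 ∨ i = k + 1 := by
          have : i < k + 1 + 1 := hi
          omega
        intro y hy
        induction hy using Submodule.span_induction with
        | mem y hy =>
          rcases hi' with hi' | rfl
          · have h1 := t_mem_Q (R := R) t hi'
            rcases hy with hy | ⟨a, ha, b, hb, rfl⟩
            · exact mem_E1 t (mul_mem h1 hy)
            · rw [← mul_assoc, ← mul_assoc]
              exact mem_E2 t (mul_mem h1 ha) hb
          · rcases hy with hy | ⟨a, ha, b, hb, rfl⟩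
            · simpa using mem_E2 t (one_mem (Q R t (k + 1))) hy
            · exact key a (ih (by omega) a ha) b hb
        | zero => simp
        | add x y _ _ hx hy => rw [mul_add]; exact add_mem hx hy
        | smul r x _ hx => rw [mul_smul_comm]; exact Submodule.smul_mem _ _ hx
      | algebraMap r => intro y hy; rw [← Algebra.smul_def]; exact Submodule.smul_mem _ _ hy
      | add x x' _ _ h h' => intro y hy; rw [add_mul]; exact add_mem (h y hy) (h' y hy)
      | mul x x' _ _ h h' => intro y hy; rw [mul_assoc]; exact h _ (h' y hy)
    intro x hx
    simpa using gen x hx 1 (mem_E1 t (one_mem _))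

/-- the span of the commutators -/
def cs (R H : Type*) [CommRing R] [Ring H] [Algebra R H] : Submodule R H :=
  Submodule.span R {z : H | ∃ x y : H, z = x * y - y * x}

/-- span of `V(0,l) z` -/
def sp (R : Type*) {H : Type*} [CommRing R] [Ring H] [Algebra R H] (t : ℕ → H) (m : ℕ) (z : H) :
    Submodule R H :=
  Submodule.span R {x | ∃ l : List ℕ, (∀ a ∈ l, 0 < a) ∧ l.sum = m ∧ x = wp t (gl 0 l) * z}

lemma main_span (hc : ∀ i j, i + 1 < j → t i * t j = t j * t i)
    (hb : ∀ i, t i * t (i + 1) * t i = t (i + 1) * t i * t (i + 1))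
    (A B : R) (N : ℕ) (hq : ∀ i, i < N → t i * t i = B • t i + A • (1 : H)) (m : ℕ) :
    m ≤ N → ∀ (k : ℕ) (z : H), (∀ i, i < m → t i * z = z * t i) → ∀ h ∈ Q R t m,
      h * dl t m k * z ∈ cs R H ⊔ sp R t (m + k + 1) z := by
  induction m with
  | zero =>
    intro _ k z _ h hh
    have : h ∈ (⊥ : Subalgebra R H) := by simpa [Q] using hh
    obtain ⟨r, rfl⟩ := Algebra.mem_bot.1 this
    apply Submodule.mem_sup_right
    rw [mul_assoc, ← Algebra.smul_def]
    refine Submodule.smul_mem _ _ (Submodule.subset_span ⟨[k + 1], by simp, by simp, ?_⟩)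
    simp [gl, dl]
  | succ m ih =>
    intro hm k z hz h hh
    have hE := Q_succ_le_E t hc hb A B N hq m (by omega) h hh
    clear hh
    have cd : ∀ i, i < m → dl t (m + 1) k * t i = t i * dl t (m + 1) k := by
      intro i hi
      apply wp_comm_lt t hc
      intro j hj
      simp only [List.mem_range'_1] at hj
      omega
    have cz : ∀ i, i < m → t i * (dl t (m + 1) k * z) = (dl t (m + 1) k * z) * t i := by
      intro i hi
      rw [← mul_assoc, ← cd i hi, mul_assoc, hz i (by omega), mul_assoc]
    induction hE using Submodule.span_induction with
    | mem x hx =>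
      rcases hx with hx | ⟨a, ha, b, hb', rfl⟩
      · have h1 := ih (by omega) 0 (dl t (m + 1) k * z) cz x hx
        have e : x * dl t m 0 * (dl t (m + 1) k * z) = x * dl t (m + 1) k * z := by
          simp [dl, wp, mul_assoc]
        rw [e] at h1
        suffices hle : sp R t (m + 0 + 1) (dl t (m + 1) k * z) ≤ sp R t (m + 1 + k + 1) z from
          (sup_le_sup_left hle (cs R H) : _ ≤ _) h1
        unfold sp
        rw [Submodule.span_le]
        rintro _ ⟨l, hl, hs, rfl⟩
        refine Submodule.subset_span ⟨l ++ [k + 1], ?_, ?_, ?_⟩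
        · intro a ha
          simp only [List.mem_append, List.mem_singleton] at ha
          rcases ha with ha | rfl
          · exact hl a ha
          · omega
        · simp [hs]; omega
        · rw [gl_append, wp_append]
          simp [gl, dl, hs, mul_assoc]
      · have h1 := ih (by omega) (k + 1) z (fun i hi => hz i (by omega)) (b * a) (mul_mem hb' ha)
        have e1 : t m * dl t (m + 1) k = dl t m (k + 1) := by
          simp [dl, List.range'_succ, wp_cons]
        have e2 : a * t m * b * dl t (m + 1) k * z = (a * dl t m (k + 1) * z) * b := by
          have := Q_comm t _ m cz b hb'
          calc _ = a * t m * (b * (dl t (m + 1) k * z)) := by simp only [mul_assoc]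
            _ = a * (t m * dl t (m + 1) k) * z * b := by rw [this]; simp only [mul_assoc]
            _ = _ := by rw [e1]
        rw [show m + (k + 1) + 1 = m + 1 + k + 1 by omega] at h1
        have h2 : (a * dl t m (k + 1) * z) * b - b * (a * dl t m (k + 1) * z) ∈
            cs R H ⊔ sp R t (m + 1 + k + 1) z :=
          Submodule.mem_sup_left (Submodule.subset_span ⟨_, _, rfl⟩)
        have h3 := add_mem h2 h1
        rw [e2]
        convert h3 using 1
        simp only [mul_assoc]
        abel
    | zero => simp
    | add x y _ _ hx hy =>
      rw [add_mul, add_mul]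
      exact add_mem hx hy
    | smul r x _ hx =>
      rw [smul_mul_assoc, smul_mul_assoc]
      exact Submodule.smul_mem _ _ hx
end span

section hecke
variable (R : Type) [CommRing R] (A B : Rˣ) (n : ℕ)

/-- generators indexed by natural numbers -/
noncomputable def tt (i : ℕ) : Hecke R A B n :=
  if h : i < n - 1 then Tgen R A B n ⟨i, h⟩ else 0

lemma tt_of_lt (i : ℕ) (h : i < n - 1) : tt R A B n i = Tgen R A B n ⟨i, h⟩ := by
  simp [tt, h]

lemma tt_comm (i j : ℕ) (h : i + 1 < j) :
    tt R A B n i * tt R A B n j = tt R A B n j * tt R A B n i := by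
  by_cases h2 : j < n - 1
  · have h1 : i < n - 1 := by omega
    rw [tt_of_lt R A B n i h1, tt_of_lt R A B n j h2]
    have := RingQuot.mkAlgHom_rel R (HeckeRel.comm (R := R) (A := A) (B := B) (n := n)
      ⟨i, h1⟩ ⟨j, h2⟩ h)
    simpa only [map_mul, Tgen] using this
  · simp [tt, h2]

lemma tt_braid (i : ℕ) :
    tt R A B n i * tt R A B n (i + 1) * tt R A B n i =
      tt R A B n (i + 1) * tt R A B n i * tt R A B n (i + 1) := by
  by_cases h2 : i + 1 < n - 1
  · have h1 : i < n - 1 := by omega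
    rw [tt_of_lt R A B n i h1, tt_of_lt R A B n _ h2]
    have := RingQuot.mkAlgHom_rel R (HeckeRel.braid (R := R) (A := A) (B := B) (n := n)
      ⟨i, h1⟩ ⟨i + 1, h2⟩ rfl)
    simpa only [map_mul, Tgen] using this
  · simp [tt, h2]

lemma tt_quad (i : ℕ) (h : i < n - 1) :
    tt R A B n i * tt R A B n i = (B : R) • tt R A B n i + (A : R) • (1 : Hecke R A B n) := by
  rw [tt_of_lt R A B n i h]
  have := RingQuot.mkAlgHom_rel R (HeckeRel.quad (R := R) (A := A) (B := B) (n := n) ⟨i, h⟩)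
  simp only [map_mul, map_add, map_smul, AlgHom.commutes] at this
  rw [Algebra.algebraMap_eq_smul_one] at this
  exact this

lemma tt_unit (i : ℕ) (h : i < n - 1) : IsUnit (tt R A B n i) := by
  have q := tt_quad R A B n i h
  set x := tt R A B n i
  have e : x * (x - (B : R) • (1 : Hecke R A B n)) = (A : R) • (1 : Hecke R A B n) := by
    rw [mul_sub, q]; simp
  have e' : (x - (B : R) • (1 : Hecke R A B n)) * x = (A : R) • (1 : Hecke R A B n) := by
    rw [sub_mul, q]; simp
  refine ⟨⟨x, ((A⁻¹ : Rˣ) : R) • (x - (B : R) • (1 : Hecke R A B n)), ?_, ?_⟩, rfl⟩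
  · rw [mul_smul_comm, e, smul_smul]; simp
  · rw [smul_mul_assoc, e', smul_smul]; simp

/-- universal property -/
noncomputable def hlift {S : Type*} [Ring S] [Algebra R S] (t : ℕ → S)
    (hc : ∀ i j, i + 1 < j → j < n - 1 → t i * t j = t j * t i)
    (hb : ∀ i, i + 1 < n - 1 → t i * t (i + 1) * t i = t (i + 1) * t i * t (i + 1))
    (hq : ∀ i, i < n - 1 → t i * t i = (B : R) • t i + (A : R) • (1 : S)) :
    Hecke R A B n →ₐ[R] S :=
  RingQuot.liftAlgHom R ⟨FreeAlgebra.lift R (fun i : Fin (n - 1) => t i), by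
    intro x y hxy
    induction hxy with
    | comm i j h => simpa using hc i j h j.2
    | braid i j h =>
      have := hb i (h ▸ j.2)
      simpa [h] using this
    | quad i => simpa [Algebra.algebraMap_eq_smul_one] using hq i i.2⟩

lemma hlift_tt {S : Type*} [Ring S] [Algebra R S] (t : ℕ → S)
    (hc : ∀ i j, i + 1 < j → j < n - 1 → t i * t j = t j * t i)
    (hb : ∀ i, i + 1 < n - 1 → t i * t (i + 1) * t i = t (i + 1) * t i * t (i + 1))
    (hq : ∀ i, i < n - 1 → t i * t i = (B : R) • t i + (A : R) • (1 : S))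
    (i : ℕ) (h : i < n - 1) : hlift R A B n t hc hb hq (tt R A B n i) = t i := by
  rw [tt_of_lt R A B n i h]
  simp [hlift, Tgen]

lemma map_wp {S S' : Type*} [Monoid S] [Monoid S'] (f : S →* S') (t : ℕ → S) (t' : ℕ → S')
    (L : List ℕ) (h : ∀ i ∈ L, f (t i) = t' i) : f (wp t L) = wp t' L := by
  induction L with
  | nil => simp [wp]
  | cons i L ih => rw [wp_cons, wp_cons, map_mul, h i (by simp), ih fun j hj => h j (by simp [hj])]

lemma Q_top : Q R (tt R A B n) (n - 1) = ⊤ := by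
  rw [eq_top_iff]
  rintro x -
  obtain ⟨y, rfl⟩ := RingQuot.mkAlgHom_surjective R (HeckeRel R A B n) x
  induction y using FreeAlgebra.induction with
  | grade0 r => rw [AlgHom.commutes]; exact Subalgebra.algebraMap_mem _ _
  | grade1 i =>
    have := t_mem_Q (R := R) (tt R A B n) i.2
    rwa [tt_of_lt R A B n i i.2] at this
  | mul a b ha hb => rw [map_mul]; exact mul_mem ha hb
  | add a b ha hb => rw [map_add]; exact add_mem ha hb

/-- Coxeter element attached to a partition -/
noncomputable def cx {S : Type*} [Monoid S] {n : ℕ} (t : ℕ → S) (p : Nat.Partition n) : S :=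
  wp t (gl 0 p.parts.toList)

lemma cx_mem {n : ℕ} (p : Nat.Partition n) (i : ℕ) (h : i ∈ gl 0 p.parts.toList) : i < n - 1 := by
  have := (gl_mem h).2
  have h2 : p.parts.toList.sum = n := by
    rw [Multiset.sum_toList, p.parts_sum]
  omega

lemma span_top (hn : 1 ≤ n) :
    Submodule.span R (Set.range fun p : Nat.Partition n => piV R A B n (cx (tt R A B n) p)) =
      ⊤ := by
  rw [eq_top_iff]
  rintro x -
  obtain ⟨h, rfl⟩ := Submodule.mkQ_surjective (commSub R A B n) x
  have h1 := main_span (tt R A B n) (tt_comm R A B n) (tt_braid R A B n) (A : R) (B : R) (n - 1)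
    (tt_quad R A B n) (n - 1) le_rfl 0 1 (by simp) h (by rw [Q_top]; trivial)
  have e : h * dl (tt R A B n) (n - 1) 0 * 1 = h := by simp [dl, wp]
  rw [e, show n - 1 + 0 + 1 = n by omega] at h1
  obtain ⟨y, hy, z, hz, rfl⟩ := Submodule.mem_sup.1 h1
  have hy' : (commSub R A B n).mkQ y = 0 := by
    rw [Submodule.mkQ_apply, Submodule.Quotient.mk_eq_zero]; exact hy
  rw [map_add, hy', zero_add]
  clear h1 e hy hy'
  induction hz using Submodule.span_induction with
  | mem x hx =>
    obtain ⟨l, hl, hs, rfl⟩ := hx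
    rw [mul_one]
    let p : Nat.Partition n := ⟨(l : Multiset ℕ), by intro i hi; exact hl i (by simpa using hi),
      by simpa using hs⟩
    have hp : l.Perm p.parts.toList := by
      rw [← Multiset.coe_eq_coe, Multiset.coe_toList]
    obtain ⟨u, ⟨u, rfl⟩, hu, -⟩ := perm_conj (tt R A B n) (tt_comm R A B n) (tt_braid R A B n)
      (n - 1) (tt_unit R A B n) hp hl 0 (by omega)
    have : (commSub R A B n).mkQ (wp (tt R A B n) (gl 0 l)) = piV R A B n (cx (tt R A B n) p) := by
      unfold piV
      rw [← sub_eq_zero, ← map_sub, Submodule.mkQ_apply, Submodule.Quotient.mk_eq_zero]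
      refine Submodule.subset_span ⟨(u⁻¹ : (Hecke R A B n)ˣ), cx (tt R A B n) p * u, ?_⟩
      rw [mul_assoc _ _ ((u⁻¹ : (Hecke R A B n)ˣ) : Hecke R A B n), Units.mul_inv, mul_one]
      unfold cx
      rw [← hu, ← mul_assoc, Units.inv_mul, one_mul]
    rw [this]
    exact Submodule.subset_span ⟨p, rfl⟩
  | zero => simp
  | add x y _ _ hx hy => rw [map_add]; exact add_mem hx hy
  | smul r x _ hx => rw [map_smul]; exact Submodule.smul_mem _ _ hx
end hecke

section basechange
open TensorProduct

lemma indep_base_change (R₀ R : Type) [CommRing R₀] [CommRing R] [Algebra R₀ R]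
    (A₀ B₀ : R₀ˣ) (A B : Rˣ) (hA : algebraMap R₀ R A₀ = A) (hB : algebraMap R₀ R B₀ = B)
    (n : ℕ) (hn : 1 ≤ n)
    (hi : LinearIndependent R₀ fun p : Nat.Partition n => piV R₀ A₀ B₀ n (cx (tt R₀ A₀ B₀ n) p)) :
    LinearIndependent R fun p : Nat.Partition n => piV R A B n (cx (tt R A B n) p) := by
  classical
  let b := Module.Basis.mk hi (span_top R₀ A₀ B₀ n hn).ge
  let t' : ℕ → R ⊗[R₀] Hecke R₀ A₀ B₀ n := fun i => 1 ⊗ₜ tt R₀ A₀ B₀ n i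
  obtain ⟨Ψ, hΨt⟩ : ∃ Ψ : Hecke R A B n →ₐ[R] R ⊗[R₀] Hecke R₀ A₀ B₀ n,
      ∀ i, i < n - 1 → Ψ (tt R A B n i) = t' i := by
    have k1 : ∀ i j, i + 1 < j → j < n - 1 → t' i * t' j = t' j * t' i := by
      intro i j h _
      simp only [t', Algebra.TensorProduct.tmul_mul_tmul, tt_comm R₀ A₀ B₀ n i j h]
    have k2 : ∀ i, i + 1 < n - 1 → t' i * t' (i + 1) * t' i = t' (i + 1) * t' i * t' (i + 1) := by
      intro i _
      simp only [t', Algebra.TensorProduct.tmul_mul_tmul, tt_braid R₀ A₀ B₀ n i]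
    have k3 : ∀ i, i < n - 1 → t' i * t' i = (B : R) • t' i + (A : R) • 1 := by
      intro i h
      simp only [t', Algebra.TensorProduct.tmul_mul_tmul, tt_quad R₀ A₀ B₀ n i h, mul_one,
        TensorProduct.tmul_add, TensorProduct.tmul_smul, ← hA, ← hB, algebraMap_smul,
        Algebra.TensorProduct.one_def]
    exact ⟨hlift R A B n t' k1 k2 k3, hlift_tt R A B n t' k1 k2 k3⟩
  have hΨ : ∀ p : Nat.Partition n,
      Ψ (cx (tt R A B n) p) = 1 ⊗ₜ (cx (tt R₀ A₀ B₀ n) p) := by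
    intro p
    have h1 : Ψ (cx (tt R A B n) p) = wp t' (gl 0 p.parts.toList) :=
      map_wp (Ψ : Hecke R A B n →* R ⊗[R₀] Hecke R₀ A₀ B₀ n) _ _ _
        (fun i hi => hΨt i (cx_mem p i hi))
    have h2 : Algebra.TensorProduct.includeRight (R := R₀) (A := R) (cx (tt R₀ A₀ B₀ n) p) =
        wp t' (gl 0 p.parts.toList) :=
      map_wp ((Algebra.TensorProduct.includeRight (R := R₀) (A := R) :
        Hecke R₀ A₀ B₀ n →ₐ[R₀] R ⊗[R₀] Hecke R₀ A₀ B₀ n) : Hecke R₀ A₀ B₀ n →* _)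
        (tt R₀ A₀ B₀ n) t' (gl 0 p.parts.toList) (fun i hi => rfl)
    rw [h1, ← h2]
    rfl
  let f : Nat.Partition n → Hecke R₀ A₀ B₀ n →ₗ[R₀] R₀ := fun p => b.coord p ∘ₗ piV R₀ A₀ B₀ n
  have hf : ∀ p x y, f p (x * y) = f p (y * x) := by
    intro p x y
    simp only [f, LinearMap.comp_apply]
    congr 1
    unfold piV
    rw [← sub_eq_zero, ← map_sub, Submodule.mkQ_apply, Submodule.Quotient.mk_eq_zero]
    exact Submodule.subset_span ⟨x, y, rfl⟩
  let g : Nat.Partition n → R ⊗[R₀] Hecke R₀ A₀ B₀ n →ₗ[R] R := fun p =>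
    (TensorProduct.AlgebraTensorModule.rid R₀ R R).toLinearMap ∘ₗ (f p).baseChange R
  have hg : ∀ p x y, g p (x * y) = g p (y * x) := by
    intro p x y
    induction x using TensorProduct.induction_on with
    | zero => simp
    | add x x' h h' => rw [add_mul, mul_add, map_add, map_add, h, h']
    | tmul r x =>
      induction y using TensorProduct.induction_on with
      | zero => simp
      | add x x' h h' => rw [add_mul, mul_add, map_add, map_add, h, h']
      | tmul s y =>
        simp only [g, Algebra.TensorProduct.tmul_mul_tmul, LinearMap.comp_apply,
          LinearMap.baseChange_tmul, hf p x y, mul_comm r s]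
  let F : Nat.Partition n → Vmod R A B n →ₗ[R] R := fun p =>
    (commSub R A B n).liftQ (g p ∘ₗ Ψ.toLinearMap) (by
      unfold commSub
      rw [Submodule.span_le]
      rintro _ ⟨x, y, rfl⟩
      simp only [SetLike.mem_coe, LinearMap.mem_ker, LinearMap.comp_apply, AlgHom.toLinearMap_apply,
        map_sub, map_mul]
      rw [hg, sub_self])
  have hF : ∀ p p', F p (piV R A B n (cx (tt R A B n) p')) = if p' = p then 1 else 0 := by
    intro p p'
    have : F p (piV R A B n (cx (tt R A B n) p')) = g p (Ψ (cx (tt R A B n) p')) := rfl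
    rw [this, hΨ]
    have h3 : f p (cx (tt R₀ A₀ B₀ n) p') = if p' = p then 1 else 0 := by
      have : piV R₀ A₀ B₀ n (cx (tt R₀ A₀ B₀ n) p') = b p' := by simp [b]
      simp only [f, LinearMap.comp_apply, this, Module.Basis.coord_apply, Module.Basis.repr_self,
        Finsupp.single_apply]
    simp only [g, LinearMap.comp_apply, LinearMap.baseChange_tmul, h3]
    split_ifs <;> simp
  rw [Fintype.linearIndependent_iff]
  intro c hc p
  have := congrArg (F p) hc
  simpa [hF] using this
end basechange

section rep

/-- the basic operator on functions on words -/
def op {X S : Type*} [CommRing S] (q B : S) (σ : X → X) (a b : X → ℕ) :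
    (X → S) →ₗ[S] (X → S) where
  toFun φ := fun w => if a w = b w then q * φ w else if a w < b w then φ (σ w) else
    q * (q - B) * φ (σ w) + B * φ w
  map_add' φ ψ := by
    funext w
    simp only [Pi.add_apply]
    split_ifs <;> ring
  map_smul' r φ := by
    funext w
    simp only [Pi.smul_apply, smul_eq_mul, RingHom.id_apply]
    split_ifs <;> ring

lemma op_apply {X S : Type*} [CommRing S] (q B : S) (σ : X → X) (a b : X → ℕ) (φ : X → S) (w : X) :
    op q B σ a b φ w = if a w = b w then q * φ w else if a w < b w then φ (σ w) else
      q * (q - B) * φ (σ w) + B * φ w := rfl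

lemma op_quad {X S : Type*} [CommRing S] (q B : S) (σ : X → X) (a b : X → ℕ)
    (h1 : ∀ x, σ (σ x) = x) (h2 : ∀ x, a (σ x) = b x) (h3 : ∀ x, b (σ x) = a x) :
    op q B σ a b * op q B σ a b = B • op q B σ a b + (q * (q - B)) • 1 := by
  refine LinearMap.ext fun φ => funext fun w => ?_
  simp only [Module.End.mul_apply, LinearMap.add_apply, LinearMap.smul_apply, Module.End.one_apply,
    Pi.add_apply, Pi.smul_apply, smul_eq_mul, op_apply, h1, h2, h3]
  rcases lt_trichotomy (a w) (b w) with h | h | h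
  · simp [h.ne, h.ne', h, h.not_gt]; ring
  · simp [h]; ring
  · simp [h.ne, h.ne', h, h.not_gt]; ring

lemma op_comm {X S : Type*} [CommRing S] (q B : S) (σ τ : X → X) (a b c d : X → ℕ)
    (h : ∀ x, σ (τ x) = τ (σ x)) (h1 : ∀ x, a (τ x) = a x) (h2 : ∀ x, b (τ x) = b x)
    (h3 : ∀ x, c (σ x) = c x) (h4 : ∀ x, d (σ x) = d x) :
    op q B σ a b * op q B τ c d = op q B τ c d * op q B σ a b := by
  refine LinearMap.ext fun φ => funext fun w => ?_
  simp only [Module.End.mul_apply, op_apply, h1, h2, h3, h4, h]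
  split_ifs <;> ring

set_option linter.unusedSimpArgs false in
lemma op_braid {X S : Type*} [CommRing S] (q B : S) (σ τ : X → X) (a b c : X → ℕ)
    (s1 : ∀ x, σ (σ x) = x) (s2 : ∀ x, τ (τ x) = x)
    (h : ∀ x, σ (τ (σ x)) = τ (σ (τ x))) (h1 : ∀ x, a (σ x) = b x) (h2 : ∀ x, b (σ x) = a x)
    (h3 : ∀ x, c (σ x) = c x) (h4 : ∀ x, a (τ x) = a x) (h5 : ∀ x, b (τ x) = c x)
    (h6 : ∀ x, c (τ x) = b x) (e1 : ∀ x, a x = b x → σ x = x) (e2 : ∀ x, b x = c x → τ x = x) :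
    op q B σ a b * op q B τ b c * op q B σ a b = op q B τ b c * op q B σ a b * op q B τ b c := by
  refine LinearMap.ext fun φ => funext fun w => ?_
  have f1 := e1 w
  have f2 := e2 w
  have f3 := e1 (τ w)
  have f4 := e2 (σ w)
  have f6 : a w = b w → τ (σ (τ w)) = σ (τ w) := fun k => by rw [← h, e1 w k]
  rw [h4, h5] at f3
  rw [h2, h3] at f4
  simp only [Module.End.mul_apply, op_apply, h1, h2, h3, h4, h5, h6, h, s1, s2]
  rcases lt_trichotomy (a w) (b w) with k1 | k1 | k1 <;>
  rcases lt_trichotomy (b w) (c w) with k2 | k2 | k2 <;>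
  rcases lt_trichotomy (a w) (c w) with k3 | k3 | k3 <;>
  first
  | (exfalso; omega)
  | (simp (disch := omega) only [if_pos, if_neg, f1, f2, f3, f4, f6, s1, s2]; done)
  | (simp (disch := omega) only [if_pos, if_neg, f1, f2, f3, f4, f6, s1, s2]; ring)
end rep

section words
open Equiv
variable {n : ℕ} {S : Type*} [CommRing S]

/-- the orbit of a word under permutation of positions -/
abbrev Wd (w₀ : Fin n → ℕ) : Type := Set.range (fun σ : Perm (Fin n) => w₀ ∘ σ)

/-- simple transposition -/
def sw (n i : ℕ) : Perm (Fin n) :=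
  if h : i + 1 < n then swap ⟨i, by omega⟩ ⟨i + 1, h⟩ else 1

/-- right action on words -/
def act (w₀ : Fin n → ℕ) (π : Perm (Fin n)) (w : Wd w₀) : Wd w₀ :=
  ⟨w.1 ∘ π, by
    obtain ⟨_, σ, rfl⟩ := w
    exact ⟨σ * π, rfl⟩⟩

lemma act_act (w₀ : Fin n → ℕ) (π π' : Perm (Fin n)) (w : Wd w₀) :
    act w₀ π (act w₀ π' w) = act w₀ (π' * π) w := rfl

lemma act_one (w₀ : Fin n → ℕ) (w : Wd w₀) : act w₀ 1 w = w := rfl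

/-- letter at a position -/
def lt (w₀ : Fin n → ℕ) (i : ℕ) (w : Wd w₀) : ℕ := if h : i < n then w.1 ⟨i, h⟩ else 0

lemma sw_sq (i : ℕ) : sw n i * sw n i = 1 := by
  unfold sw
  split_ifs <;> simp

lemma sw_comm (i j : ℕ) (h : i + 1 < j) (hj : j < n - 1) : sw n i * sw n j = sw n j * sw n i := by
  have h1 : i + 1 < n := by omega
  have h2 : j + 1 < n := by omega
  simp only [sw, h1, h2, dif_pos]
  ext ⟨x, hx⟩
  simp only [Perm.mul_apply, swap_apply_def, Fin.ext_iff, apply_ite Fin.val]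
  split_ifs <;> omega

lemma sw_braid (i : ℕ) (h : i + 1 < n - 1) :
    sw n i * sw n (i + 1) * sw n i = sw n (i + 1) * sw n i * sw n (i + 1) := by
  have h1 : i + 1 < n := by omega
  have h2 : i + 1 + 1 < n := by omega
  simp only [sw, h1, h2, dif_pos]
  ext ⟨x, hx⟩
  simp only [Perm.mul_apply, swap_apply_def, Fin.ext_iff, apply_ite Fin.val]
  split_ifs <;> omega

lemma lt_l (w₀ : Fin n → ℕ) (i : ℕ) (h : i < n - 1) (w : Wd w₀) :
    lt w₀ i (act w₀ (sw n i) w) = lt w₀ (i + 1) w := by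
  have h1 : i + 1 < n := by omega
  have h2 : i < n := by omega
  simp [lt, act, sw, h1, h2]

lemma lt_r (w₀ : Fin n → ℕ) (i : ℕ) (h : i < n - 1) (w : Wd w₀) :
    lt w₀ (i + 1) (act w₀ (sw n i) w) = lt w₀ i w := by
  have h1 : i + 1 < n := by omega
  have h2 : i < n := by omega
  simp [lt, act, sw, h1, h2]

lemma lt_o (w₀ : Fin n → ℕ) (i j : ℕ) (hj : j ≠ i) (hj' : j ≠ i + 1) (w : Wd w₀) :
    lt w₀ j (act w₀ (sw n i) w) = lt w₀ j w := by
  unfold lt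
  split_ifs with h
  · simp only [act, sw]
    split_ifs with h1
    · rw [Function.comp_apply, swap_apply_of_ne_of_ne]
      · simpa [Fin.ext_iff] using hj
      · simpa [Fin.ext_iff] using hj'
    · rfl
  · rfl

lemma act_fix (w₀ : Fin n → ℕ) (i : ℕ) (h : i < n - 1) (w : Wd w₀)
    (hw : lt w₀ i w = lt w₀ (i + 1) w) : act w₀ (sw n i) w = w := by
  have h1 : i + 1 < n := by omega
  have h2 : i < n := by omega
  simp only [lt, h1, h2, dif_pos] at hw
  apply Subtype.ext
  funext x
  simp only [act, sw, h1, dif_pos, Function.comp_apply, swap_apply_def]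
  split_ifs with k1 k2
  · rw [← hw, k1]
  · rw [hw, k2]
  · rfl

/-- matrix representing a generator -/
noncomputable def rho (q B : S) (w₀ : Fin n → ℕ) (i : ℕ) : Matrix (Wd w₀) (Wd w₀) S :=
  LinearMap.toMatrixAlgEquiv' (op q B (act w₀ (sw n i)) (lt w₀ i) (lt w₀ (i + 1)))

lemma rho_comm (q B : S) (w₀ : Fin n → ℕ) (i j : ℕ) (h : i + 1 < j) (hj : j < n - 1) :
    rho q B w₀ i * rho q B w₀ j = rho q B w₀ j * rho q B w₀ i := by
  unfold rho
  rw [← map_mul, ← map_mul, op_comm]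
  · intro x
    rw [act_act, act_act, sw_comm i j h hj]
  all_goals
    intro x
    apply lt_o <;> omega

lemma rho_braid (q B : S) (w₀ : Fin n → ℕ) (i : ℕ) (h : i + 1 < n - 1) :
    rho q B w₀ i * rho q B w₀ (i + 1) * rho q B w₀ i =
      rho q B w₀ (i + 1) * rho q B w₀ i * rho q B w₀ (i + 1) := by
  unfold rho
  simp only [← map_mul]
  rw [op_braid]
  · intro x; rw [act_act, sw_sq, act_one]
  · intro x; rw [act_act, sw_sq, act_one]
  · intro x; simp only [act_act]; rw [sw_braid i h]
  · intro x; exact lt_l w₀ i (by omega) x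
  · intro x; exact lt_r w₀ i (by omega) x
  · intro x; apply lt_o <;> omega
  · intro x; apply lt_o <;> omega
  · intro x; exact lt_l w₀ (i + 1) (by omega) x
  · intro x; exact lt_r w₀ (i + 1) (by omega) x
  · intro x; exact act_fix w₀ i (by omega) x
  · intro x; exact act_fix w₀ (i + 1) (by omega) x

lemma rho_quad (q B : S) (w₀ : Fin n → ℕ) (i : ℕ) (h : i < n - 1) :
    rho q B w₀ i * rho q B w₀ i = B • rho q B w₀ i + (q * (q - B)) • 1 := by
  unfold rho
  rw [← map_mul, op_quad]
  · rw [map_add, map_smul, map_smul, map_one]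
  · intro x; rw [act_act, sw_sq, act_one]
  · intro x; exact lt_l w₀ i h x
  · intro x; exact lt_r w₀ i h x

lemma rho_map {S' : Type*} [CommRing S'] (f : S →+* S') (q B : S) (w₀ : Fin n → ℕ) (i : ℕ) :
    f.mapMatrix (rho q B w₀ i) = rho (f q) (f B) w₀ i := by
  ext w w'
  simp only [rho, RingHom.mapMatrix_apply, Matrix.map_apply, LinearMap.toMatrixAlgEquiv'_apply,
    op_apply]
  split_ifs <;> simp_all [Pi.single_apply, apply_ite f] 

lemma cx_map {S' : Type*} [CommRing S'] (f : S →+* S') (q B : S) (w₀ : Fin n → ℕ) (L : List ℕ) :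
    f (wp (rho q B w₀) L).trace = (wp (rho (f q) (f B) w₀) L).trace := by
  rw [← map_wp ((f.mapMatrix : Matrix (Wd w₀) (Wd w₀) S →+* Matrix (Wd w₀) (Wd w₀) S') :
    Matrix (Wd w₀) (Wd w₀) S →* Matrix (Wd w₀) (Wd w₀) S') (rho q B w₀) (rho (f q) (f B) w₀) L
    (fun i _ => rho_map f q B w₀ i)]
  exact (AddMonoidHom.map_trace (f : S →+ S') _)

/-- permutation along a list -/
def pm (n : ℕ) (L : List ℕ) : Perm (Fin n) := wp (sw n) L

lemma rho_spec (w₀ : Fin n → ℕ) (L : List ℕ) (hL : ∀ i ∈ L, i < n - 1) (w w' : Wd w₀) :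
    wp (rho (1 : ℤ) 0 w₀) L w w' = if act w₀ (pm n L) w = w' then 1 else 0 := by
  induction L generalizing w with
  | nil => simp [wp, pm, act_one, Matrix.one_apply]
  | cons i L ih =>
    have e : ∀ w'' , rho (1 : ℤ) 0 w₀ i w w'' = if w'' = act w₀ (sw n i) w then 1 else 0 := by
      intro w''
      have := act_fix w₀ i (hL i (by simp)) w
      simp only [rho, LinearMap.toMatrixAlgEquiv'_apply, op_apply]
      have sg : ∀ u v : Wd w₀, (Pi.single u (1 : ℤ) : Wd w₀ → ℤ) v = if u = v then 1 else 0 := by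
        intro u v
        by_cases huv : u = v
        · subst huv; simp
        · rw [Pi.single_eq_of_ne (Ne.symm huv), if_neg huv]
      split_ifs <;> simp_all
    rw [wp_cons, Matrix.mul_apply]
    simp only [e, ite_mul, one_mul, zero_mul, Finset.sum_ite_eq', Finset.sum_ite_eq,
      Finset.mem_univ, if_true]
    rw [ih (fun j hj => hL j (by simp [hj])), act_act]
    simp only [pm, wp_cons]
    congr

lemma trace_spec (w₀ : Fin n → ℕ) (L : List ℕ) (hL : ∀ i ∈ L, i < n - 1) :
    (wp (rho (1 : ℤ) 0 w₀) L).trace =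
      ((Finset.univ.filter fun w : Wd w₀ => act w₀ (pm n L) w = w).card : ℤ) := by
  simp [Matrix.trace, rho_spec w₀ L hL]

lemma pm_fix (L : List ℕ) (j : ℕ) (hj : j < n) (h : ∀ i ∈ L, j < i) :
    pm n L ⟨j, hj⟩ = ⟨j, hj⟩ := by
  induction L with
  | nil => simp [pm, wp]
  | cons i L ih =>
    have := h i (by simp)
    rw [pm, wp_cons, Perm.mul_apply, ← pm, ih fun k hk => h k (by simp [hk])]
    unfold sw
    split_ifs with h1
    · rw [swap_apply_of_ne_of_ne] <;> simp [Fin.ext_iff] <;> omega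
    · rfl

lemma fix_imp (w₀ : Fin n → ℕ) (L : List ℕ) (hL : ∀ i ∈ L, i < n - 1) (hs : L.Pairwise (· < ·))
    (w : Wd w₀) (h : act w₀ (pm n L) w = w) : ∀ i ∈ L, lt w₀ i w = lt w₀ (i + 1) w := by
  induction L with
  | nil => simp
  | cons i L ih =>
    have hi := hL i (by simp)
    have h1 : i + 1 < n := by omega
    have h2 : i < n := by omega
    rw [List.pairwise_cons] at hs
    have key : lt w₀ i w = lt w₀ (i + 1) w := by
      have k := congrFun (congrArg Subtype.val h) ⟨i, h2⟩
      simp only [act, Function.comp_apply] at k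
      rw [pm, wp_cons, Perm.mul_apply, ← pm, pm_fix L i h2 hs.1] at k
      simp only [lt, h1, h2, dif_pos]
      rw [← k]
      simp [sw, h1]
    have h' : act w₀ (pm n L) w = w := by
      rw [pm, wp_cons, ← act_act, act_fix w₀ i hi w key] at h
      exact h
    intro j hj
    rcases List.mem_cons.1 hj with rfl | hj
    · exact key
    · exact ih (fun k hk => hL k (by simp [hk])) hs.2 h' j hj

lemma imp_fix (w₀ : Fin n → ℕ) (L : List ℕ) (hL : ∀ i ∈ L, i < n - 1)
    (w : Wd w₀) (h : ∀ i ∈ L, lt w₀ i w = lt w₀ (i + 1) w) : act w₀ (pm n L) w = w := by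
  induction L with
  | nil => rfl
  | cons i L ih =>
    rw [pm, wp_cons, ← act_act, act_fix w₀ i (hL i (by simp)) w (h i (by simp))]
    exact ih (fun k hk => hL k (by simp [hk])) (fun k hk => h k (by simp [hk]))
end words

section combi

lemma zr_count (l g : List ℕ) (hlen : g.length = l.length) (hg : g.Nodup) :
    g.map (fun a => (List.zipWith List.replicate l g).flatten.count a) = l := by
  induction l generalizing g with
  | nil => simpa using hlen
  | cons x l ih =>
    cases g with
    | nil => simp at hlen
    | cons a g =>
      rw [List.nodup_cons] at hg
      have h0 : ∀ (l' : List ℕ) , a ∉ (List.zipWith List.replicate l' g).flatten := by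
        intro l' hm
        rw [List.mem_flatten] at hm
        obtain ⟨r, hr, har⟩ := hm
        rw [List.mem_iff_getElem] at hr
        obtain ⟨i, hi, rfl⟩ := hr
        rw [List.getElem_zipWith] at har
        have := List.eq_of_mem_replicate har
        exact hg.1 (this ▸ List.getElem_mem _)
      simp only [List.zipWith_cons_cons, List.flatten_cons, List.map_cons, List.count_append,
        List.count_replicate_self, List.count_eq_zero_of_not_mem (h0 l), add_zero]
      congr 1
      refine Eq.trans (List.map_congr_left ?_) (ih g (by simpa using hlen) hg.2)
      intro b hb
      have : a ≠ b := fun h => hg.1 (h ▸ hb)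
      rw [List.count_replicate]
      simp [this]

lemma zr_sub (l g : List ℕ) (a : ℕ) (ha : a ∈ (List.zipWith List.replicate l g).flatten) :
    a ∈ g := by
  rw [List.mem_flatten] at ha
  obtain ⟨r, hr, har⟩ := ha
  rw [List.mem_iff_getElem] at hr
  obtain ⟨i, hi, rfl⟩ := hr
  rw [List.getElem_zipWith] at har
  have := List.eq_of_mem_replicate har
  exact this ▸ List.getElem_mem _

lemma zr_sup (l g : List ℕ) (hlen : g.length = l.length) (hl : ∀ x ∈ l, 0 < x) (a : ℕ)
    (ha : a ∈ g) : a ∈ (List.zipWith List.replicate l g).flatten := by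
  induction l generalizing g with
  | nil => simp at hlen; simp [hlen] at ha
  | cons x l ih =>
    cases g with
    | nil => simp at hlen
    | cons b g =>
      simp only [List.zipWith_cons_cons, List.flatten_cons, List.mem_append, List.mem_replicate]
      rcases List.mem_cons.1 ha with rfl | h
      · left; exact ⟨(hl x (by simp)).ne', rfl⟩
      · right; exact ih g (by simpa using hlen) (fun y hy => hl y (by simp [hy])) h

lemma zr_card (l g : List ℕ) (hlen : g.length = l.length) :
    (List.zipWith List.replicate l g).flatten.toFinset.card ≤ l.length := by
  rw [← hlen]
  refine le_trans (Finset.card_le_card ?_) (List.toFinset_card_le g)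
  intro a ha
  rw [List.mem_toFinset] at *
  exact zr_sub l g a ha

lemma zr_main (l g : List ℕ) (hlen : g.length = l.length) (κ : Multiset ℕ)
    (hκ : κ = ((List.zipWith List.replicate l g).flatten : List ℕ))
    (hc : l.length ≤ κ.toFinset.card) :
    (l : Multiset ℕ) = κ.toFinset.val.map (fun a => κ.count a) := by
  subst hκ
  simp only [List.toFinset_coe, Multiset.coe_count] at hc ⊢
  have hsub : (List.zipWith List.replicate l g).flatten.toFinset ⊆ g.toFinset := by
    intro a ha
    rw [List.mem_toFinset] at *
    exact zr_sub l g a ha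
  have h1 := Finset.card_le_card hsub
  have h2 := List.toFinset_card_le g
  have hg : g.Nodup := by
    rw [← Multiset.coe_nodup, ← Multiset.toFinset_card_eq_card_iff_nodup, List.toFinset_coe,
      Multiset.coe_card]
    omega
  rw [Finset.eq_of_subset_of_card_le hsub (by omega)]
  conv_lhs => rw [← zr_count l g hlen hg]
  rw [List.toFinset_val, hg.dedup, Multiset.map_coe]

/-- the standard word of a composition -/
def wd : ℕ → List ℕ → ℕ → ℕ
  | _, [], _ => 0
  | s, a :: l, p => if p < s + a then s else wd (s + a) l p

/-- starting points of the blocks -/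
def starts : ℕ → List ℕ → List ℕ
  | _, [] => []
  | s, a :: l => s :: starts (s + a) l

lemma starts_length (s : ℕ) (l : List ℕ) : (starts s l).length = l.length := by
  induction l generalizing s with
  | nil => rfl
  | cons a l ih => simp [starts, ih]

lemma starts_ge (s : ℕ) (l : List ℕ) : ∀ x ∈ starts s l, s ≤ x := by
  induction l generalizing s with
  | nil => simp [starts]
  | cons a l ih =>
    intro x hx
    rcases List.mem_cons.1 hx with rfl | h
    · rfl
    · have := ih _ x h
      omega

lemma starts_nodup (s : ℕ) (l : List ℕ) (hl : ∀ x ∈ l, 0 < x) : (starts s l).Nodup := by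
  induction l generalizing s with
  | nil => simp [starts]
  | cons a l ih =>
    rw [starts, List.nodup_cons]
    refine ⟨fun h => ?_, ih _ fun y hy => hl y (by simp [hy])⟩
    have := starts_ge _ _ _ h
    have := hl a (by simp)
    omega

lemma wd_map (s : ℕ) (l : List ℕ) :
    (List.range' s l.sum).map (wd s l) = (List.zipWith List.replicate l (starts s l)).flatten := by
  induction l generalizing s with
  | nil => simp
  | cons a l ih =>
    rw [List.sum_cons, ← List.range'_append_1, List.map_append, starts, List.zipWith_cons_cons,
      List.flatten_cons, ← ih]
    congr 1
    · rw [List.eq_replicate_iff]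
      refine ⟨by simp, ?_⟩
      intro b hb
      rw [List.mem_map] at hb
      obtain ⟨p, hp, rfl⟩ := hb
      rw [List.mem_range'_1] at hp
      simp [wd, hp.2]
    · apply List.map_congr_left
      intro p hp
      rw [List.mem_range'_1] at hp
      simp [wd, hp.1]

lemma fx_map (w : ℕ → ℕ) (s : ℕ) (l : List ℕ) (h : ∀ i ∈ gl s l, w i = w (i + 1)) :
    (List.range' s l.sum).map w =
      (List.zipWith List.replicate l ((starts s l).map w)).flatten := by
  induction l generalizing s with
  | nil => simp
  | cons a l ih =>
    rw [List.sum_cons, ← List.range'_append_1, List.map_append, starts, List.map_cons,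
      List.zipWith_cons_cons, List.flatten_cons, ← ih]
    · congr 1
      rw [List.eq_replicate_iff]
      refine ⟨by simp, ?_⟩
      intro b hb
      rw [List.mem_map] at hb
      obtain ⟨p, hp, rfl⟩ := hb
      rw [List.mem_range'_1] at hp
      obtain ⟨d, rfl⟩ := Nat.exists_eq_add_of_le hp.1
      have : ∀ e, e < a → w (s + e) = w s := by
        intro e
        induction e with
        | zero => intro _; rfl
        | succ e ihe =>
          intro he
          rw [← ihe (by omega), ← add_assoc]
          refine (h (s + e) ?_).symm
          simp only [gl, List.mem_append, List.mem_range'_1]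
          omega
      exact this d (by omega)
    · intro i hi
      apply h
      simp [gl, hi]

lemma wd_adj (s : ℕ) (l : List ℕ) : ∀ i ∈ gl s l, wd s l i = wd s l (i + 1) := by
  induction l generalizing s with
  | nil => simp [wd]
  | cons a l ih =>
    intro i hi
    simp only [gl, List.mem_append, List.mem_range'_1] at hi
    rcases hi with hi | hi
    · have h1 : i < s + a := by omega
      have h2 : i + 1 < s + a := by omega
      simp [wd, h1, h2]
    · have h3 := (gl_mem hi).1
      have h1 : ¬ i < s + a := by omega
      have h2 : ¬ i + 1 < s + a := by omega
      simp only [wd, h1, h2, if_false]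
      exact ih _ i hi


/-- the standard word of a partition -/
noncomputable def wpt {n : ℕ} (p : Nat.Partition n) : Fin n → ℕ := fun i => wd 0 p.parts.toList i

lemma parts_sum_list {n : ℕ} (p : Nat.Partition n) : p.parts.toList.sum = n := by
  rw [Multiset.sum_toList, p.parts_sum]

lemma parts_len {n : ℕ} (p : Nat.Partition n) : p.parts.toList.length = p.parts.card := by
  simp

lemma parts_list_pos {n : ℕ} (p : Nat.Partition n) : ∀ x ∈ p.parts.toList, 0 < x := by
  intro x hx
  exact p.parts_pos (Multiset.mem_toList.1 hx)

lemma content {n : ℕ} (w₀ : Fin n → ℕ) (w : Wd w₀) :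
    (Finset.univ.val.map w.1 : Multiset ℕ) = Finset.univ.val.map w₀ := by
  obtain ⟨_, σ, rfl⟩ := w
  change Multiset.map (w₀ ∘ σ) Finset.univ.val = _
  rw [← Multiset.map_map]
  congr 1
  exact (Multiset.map_univ_val_equiv σ)

lemma content_list {n : ℕ} (w : Fin n → ℕ) (v : ℕ → ℕ) (h : ∀ i : Fin n, w i = v i) :
    (Finset.univ.val.map w : Multiset ℕ) = ((List.range' 0 n).map v : List ℕ) := by
  rw [Fin.univ_val_map, ← List.range_eq_range', ← List.map_coe_finRange_eq_range, List.map_map,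
    List.ofFn_eq_map]
  congr 1
  apply List.map_congr_left
  intro i _
  exact h i

lemma wpt_adj {n : ℕ} (p : Nat.Partition n) :
    act (wpt p) (pm n (gl 0 p.parts.toList)) ⟨wpt p, 1, rfl⟩ = ⟨wpt p, 1, rfl⟩ := by
  apply imp_fix _ _ (cx_mem p)
  intro i hi
  have := cx_mem p i hi
  have h1 : i + 1 < n := by omega
  have h2 : i < n := by omega
  simp only [lt, h1, h2, dif_pos, wpt]
  exact wd_adj _ _ i hi

lemma key_comb {n : ℕ} (p m : Nat.Partition n) (w : Wd (wpt m))
    (h : act (wpt m) (pm n (gl 0 p.parts.toList)) w = w) :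
    m.parts.card ≤ p.parts.card ∧ (p.parts.card = m.parts.card → p = m) := by
  have hfix := fix_imp (wpt m) _ (cx_mem p) (gl_sorted _ _) w h
  set κ : Multiset ℕ := Finset.univ.val.map (wpt m) with hκ
  have e1 := content_list (wpt m) (wd 0 m.parts.toList) (fun i => rfl)
  have e1' := wd_map 0 m.parts.toList
  rw [parts_sum_list] at e1'
  rw [e1', ← hκ] at e1
  have e2 := content_list w.1 (fun i => lt (wpt m) i w) (fun i => by simp [lt])
  have e2' := fx_map (fun i => lt (wpt m) i w) 0 p.parts.toList hfix
  rw [parts_sum_list] at e2'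
  rw [e2', content, ← hκ] at e2
  have c1 : m.parts.card ≤ κ.toFinset.card := by
    rw [← parts_len, ← starts_length 0, ← List.toFinset_card_of_nodup
      (starts_nodup 0 _ (parts_list_pos m))]
    apply Finset.card_le_card
    intro a ha
    rw [e1, List.toFinset_coe]
    rw [List.mem_toFinset] at *
    exact zr_sup _ _ (starts_length _ _) (parts_list_pos m) a ha
  have c2 : κ.toFinset.card ≤ p.parts.card := by
    rw [e2, List.toFinset_coe, ← parts_len]
    exact zr_card _ _ (by simp [starts_length])
  refine ⟨c1.trans c2, fun hpm => ?_⟩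
  have f1 := zr_main _ _ (starts_length _ _) κ e1 (by rw [parts_len]; exact c1)
  have f2 := zr_main _ _ (by simp [starts_length]) κ e2 (by rw [parts_len]; omega)
  rw [← f1, Multiset.coe_toList, Multiset.coe_toList] at f2
  exact Nat.Partition.ext f2

/-- the matrix of traces -/
noncomputable def trm (S : Type*) [CommRing S] (q B : S) (n : ℕ) :
    Matrix (Nat.Partition n) (Nat.Partition n) S :=
  fun p m => (cx (rho q B (wpt m)) p).trace

lemma trm_map {S S' : Type*} [CommRing S] [CommRing S'] (f : S →+* S') (q B : S) (n : ℕ) :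
    f.mapMatrix (trm S q B n) = trm S' (f q) (f B) n := by
  ext p m
  simp only [trm, RingHom.mapMatrix_apply, Matrix.map_apply, cx]
  exact cx_map f q B _ _

lemma trm_det_int (n : ℕ) : (trm ℤ 1 0 n).det ≠ 0 := by
  intro hdet
  obtain ⟨c, hc, hz⟩ := Matrix.exists_vecMul_eq_zero_iff.2 hdet
  have hne : (Finset.univ.filter fun p => c p ≠ 0).Nonempty := by
    obtain ⟨p, hp⟩ := Function.ne_iff.1 hc
    exact ⟨p, by simpa using hp⟩
  obtain ⟨p, hp, hmax⟩ := Finset.exists_max_image _ (fun p : Nat.Partition n => p.parts.card) hne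
  rw [Finset.mem_filter] at hp
  have h := congrFun hz p
  rw [Matrix.vecMul, dotProduct, Finset.sum_eq_single p] at h
  · rcases mul_eq_zero.1 h with h | h
    · exact hp.2 h
    · rw [trm, cx, trace_spec _ _ (cx_mem p)] at h
      have h' := Int.natCast_eq_zero.1 h
      rw [Finset.card_eq_zero] at h'
      have : (⟨wpt p, 1, rfl⟩ : Wd (wpt p)) ∈
          Finset.univ.filter (fun w => act (wpt p) (pm n (gl 0 p.parts.toList)) w = w) := by
        rw [Finset.mem_filter]
        exact ⟨Finset.mem_univ _, wpt_adj p⟩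
      rw [h'] at this
      simp at this
  · intro m _ hm
    by_contra hcon
    have hcm : c m ≠ 0 := left_ne_zero_of_mul hcon
    have htr : trm ℤ 1 0 n m p ≠ 0 := right_ne_zero_of_mul hcon
    rw [trm, cx, trace_spec _ _ (cx_mem m)] at htr
    have h' := Int.natCast_ne_zero.1 htr
    obtain ⟨w, hw⟩ := Finset.card_ne_zero.1 h'
    rw [Finset.mem_filter] at hw
    obtain ⟨k1, k2⟩ := key_comb m p w hw.2
    have := hmax m (by simpa using hcm)
    exact hm (k2 (le_antisymm this k1))
  · simp
end combi

section generic
open Polynomial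

lemma indep_of_det (R₀ K : Type) [CommRing R₀] [CommRing K] [IsDomain K] [Algebra R₀ K]
    (hinj : Function.Injective (algebraMap R₀ K)) (A₀ B₀ : R₀ˣ) (q b : K)
    (hA : algebraMap R₀ K A₀ = q * (q - b)) (hB : algebraMap R₀ K B₀ = b) (n : ℕ)
    (hdet : (trm K q b n).det ≠ 0) :
    LinearIndependent R₀ fun p : Nat.Partition n => piV R₀ A₀ B₀ n (cx (tt R₀ A₀ B₀ n) p) := by
  rw [Fintype.linearIndependent_iff]
  intro c hc
  have key : Matrix.vecMul (fun p => algebraMap R₀ K (c p)) (trm K q b n) = 0 := by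
    funext m
    have k3 : ∀ i, i < n - 1 → rho q b (wpt m) i * rho q b (wpt m) i =
        (B₀ : R₀) • rho q b (wpt m) i + (A₀ : R₀) • (1 : Matrix (Wd (wpt m)) (Wd (wpt m)) K) := by
      intro i hi
      rw [rho_quad q b _ i hi, ← algebraMap_smul K (B₀ : R₀), ← algebraMap_smul K (A₀ : R₀), hA, hB]
    let f := hlift R₀ A₀ B₀ n (rho q b (wpt m)) (rho_comm q b (wpt m)) (rho_braid q b (wpt m)) k3
    let τ : Hecke R₀ A₀ B₀ n →ₗ[R₀] K := (Matrix.traceLinearMap (Wd (wpt m)) R₀ K).comp f.toLinearMap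
    have hτ : commSub R₀ A₀ B₀ n ≤ LinearMap.ker τ := by
      unfold commSub
      rw [Submodule.span_le]
      rintro _ ⟨x, y, rfl⟩
      simp only [SetLike.mem_coe, LinearMap.mem_ker, τ, LinearMap.comp_apply, map_sub,
        AlgHom.toLinearMap_apply, map_mul, Matrix.traceLinearMap_apply]
      rw [Matrix.trace_mul_comm, sub_self]
    have hcx : ∀ p : Nat.Partition n, τ (cx (tt R₀ A₀ B₀ n) p) = trm K q b n p m := by
      intro p
      have : f (cx (tt R₀ A₀ B₀ n) p) = cx (rho q b (wpt m)) p :=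
        map_wp (f : Hecke R₀ A₀ B₀ n →* Matrix (Wd (wpt m)) (Wd (wpt m)) K) (tt R₀ A₀ B₀ n)
          (rho q b (wpt m)) (gl 0 p.parts.toList)
          fun i hi => hlift_tt R₀ A₀ B₀ n (rho q b (wpt m)) _ _ _ i (cx_mem p i hi)
      simp only [τ, LinearMap.comp_apply, AlgHom.toLinearMap_apply, this,
        Matrix.traceLinearMap_apply, trm]
    have h := congrArg ((commSub R₀ A₀ B₀ n).liftQ τ hτ) hc
    rw [map_sum, map_zero] at h
    rw [Matrix.vecMul, dotProduct, Pi.zero_apply, ← h]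
    apply Finset.sum_congr rfl
    intro p _
    rw [map_smul, piV, Submodule.mkQ_apply, Submodule.liftQ_apply, hcx, Algebra.smul_def]
  have hz : (fun p => algebraMap R₀ K (c p)) = 0 := by
    by_contra hne
    exact hdet (Matrix.exists_vecMul_eq_zero_iff.1 ⟨_, hne, key⟩)
  intro p
  apply hinj
  rw [map_zero]
  exact congrFun hz p

/-- generic ring before localisation -/
abbrev GP : Type := ℤ[X][X]

/-- generic ring -/
abbrev GR : Type := Localization.Away (X * C X : GP)

lemma GP_ne : (X * C X : GP) ≠ 0 := mul_ne_zero X_ne_zero (by simp)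

lemma trm_det_gen (n : ℕ) :
    (trm (FractionRing GP) (algebraMap GP _ X) (algebraMap GP _ (C X)) n).det ≠ 0 := by
  rw [← trm_map, ← RingHom.map_det]
  intro h
  rw [map_eq_zero_iff _ (IsFractionRing.injective GP (FractionRing GP))] at h
  have h2 := congrArg (eval₂RingHom (evalRingHom (0 : ℤ)) 1) h
  rw [RingHom.map_det, trm_map, map_zero] at h2
  simp only [coe_eval₂RingHom, eval₂_X, eval₂_C, coe_evalRingHom, eval_X] at h2
  exact trm_det_int n h2

lemma comp_inj : Function.Injective (compRingHom (X * (X - C X) : GP)) := by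
  rw [injective_iff_map_eq_zero]
  intro p hp
  have hd : (X * (X - C X) : GP).natDegree = 2 := by
    rw [natDegree_mul X_ne_zero (X_sub_C_ne_zero _), natDegree_X, natDegree_X_sub_C]
  rw [coe_compRingHom_apply, comp_eq_zero_iff] at hp
  rcases hp with h | ⟨_, h⟩
  · exact h
  · rw [h, natDegree_C] at hd
    omega

lemma gen_exists : ∃ (A₀ B₀ : GRˣ), (A₀ : GR) = algebraMap GP GR X ∧
    (B₀ : GR) = algebraMap GP GR (C X) := by
  have h := IsLocalization.Away.algebraMap_isUnit (S := GR) (X * C X : GP)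
  rw [map_mul, IsUnit.mul_iff] at h
  exact ⟨h.1.unit, h.2.unit, rfl, rfl⟩

lemma gen_indep (A₀ B₀ : GRˣ) (hA : (A₀ : GR) = algebraMap GP GR X)
    (hB : (B₀ : GR) = algebraMap GP GR (C X)) (n : ℕ) :
    LinearIndependent GR fun p : Nat.Partition n => piV GR A₀ B₀ n (cx (tt GR A₀ B₀ n) p) := by
  let g : GP →+* FractionRing GP := (algebraMap GP (FractionRing GP)).comp
    (compRingHom (X * (X - C X) : GP))
  have hg : Function.Injective g :=
    (IsFractionRing.injective GP (FractionRing GP)).comp comp_inj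
  have hu : IsUnit (g (X * C X)) := by
    rw [isUnit_iff_ne_zero, Ne, map_eq_zero_iff g hg]
    exact GP_ne
  let φ : GR →+* FractionRing GP := IsLocalization.Away.lift (X * C X : GP) hu
  have hφ : ∀ x, φ (algebraMap GP GR x) = g x := fun x => IsLocalization.Away.lift_eq _ hu x
  letI : Algebra GR (FractionRing GP) := φ.toAlgebra
  refine indep_of_det GR (FractionRing GP) ?_ A₀ B₀ (algebraMap GP _ X) (algebraMap GP _ (C X))
    ?_ ?_ n (trm_det_gen n)
  · change Function.Injective φ
    rw [injective_iff_map_eq_zero]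
    intro x hx
    obtain ⟨a, s, rfl⟩ := IsLocalization.exists_mk'_eq (Submonoid.powers (X * C X : GP)) x
    have h1 : φ (IsLocalization.mk' GR a s * algebraMap GP GR s) = 0 := by
      rw [map_mul, hx, zero_mul]
    rw [IsLocalization.mk'_spec, hφ, map_eq_zero_iff g hg] at h1
    rw [h1, IsLocalization.mk'_zero]
  · change φ A₀ = _
    rw [hA, hφ]
    simp [g]
  · change φ B₀ = _
    rw [hB, hφ]
    simp [g]

lemma indep_all (R : Type) [CommRing R] (A B : Rˣ) (n : ℕ) (hn : 1 ≤ n) :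
    LinearIndependent R fun p : Nat.Partition n => piV R A B n (cx (tt R A B n) p) := by
  obtain ⟨A₀, B₀, hA, hB⟩ := gen_exists
  let g : GP →+* R := eval₂RingHom (eval₂RingHom (Int.castRingHom R) (B : R)) (A : R)
  have gA : g X = A := by simp [g]
  have gB : g (C X) = B := by simp [g]
  have hu : IsUnit (g (X * C X)) := by
    rw [map_mul, gA, gB]
    exact A.isUnit.mul B.isUnit
  let φ : GR →+* R := IsLocalization.Away.lift (X * C X : GP) hu
  have hφ : ∀ x, φ (algebraMap GP GR x) = g x := fun x => IsLocalization.Away.lift_eq _ hu x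
  letI : Algebra GR R := φ.toAlgebra
  refine indep_base_change GR R A₀ B₀ A B ?_ ?_ n hn (gen_indep A₀ B₀ hA hB n)
  · change φ A₀ = _
    rw [hA, hφ, gA]
  · change φ B₀ = _
    rw [hB, hφ, gB]
end generic

end HeckeAux

/-- `V_n` is a free `R`-module whose rank equals `P(n)`, the number of
partitions of `n`. -/
theorem Vmod_free_rank_partitions (R : Type) [CommRing R] [IsDomain R] (A B : Rˣ)
    (n : ℕ) (hn : 1 ≤ n) :
    Module.Free R (Vmod R A B n) ∧
      Module.rank R (Vmod R A B n) = Fintype.card (Nat.Partition n) := by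
  let b := Module.Basis.mk (HeckeAux.indep_all R A B n hn) (HeckeAux.span_top R A B n hn).ge
  exact ⟨Module.Free.of_basis b, rank_eq_card_basis b⟩
end
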